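/- Let ⟨S | R⟩ and ⟨S' | R'⟩ be two finite presentations of the same group Γ (i.e., there is a group isomorphism F(S)/⟨⟨R⟩⟩ ≅ F(S')/⟨⟨R'⟩⟩), and let 𝒞 be a family of groups with bi-invariant metrics such that each (G, d) ∈ 𝒞 is a complete metric space. Then Γ has the property of defect diminishing with respect to 𝒞 for the presentation ⟨S | R⟩ if and only if it has the property of defect diminishing for the presentation ⟨S' | R'⟩. -/

import Mathlib

/-- A group equipped with a bi-invariant metric. -/
structure MetricGroup where
  carrier : Type
  [group : Group carrier]
  [metric : MetricSpace carrier]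
  dist_left_invariant : ∀ g x y : carrier, dist (g * x) (g * y) = dist x y
  dist_right_invariant : ∀ g x y : carrier, dist (x * g) (y * g) = dist x y

attribute [instance] MetricGroup.group MetricGroup.metric

/-- defect(φ) = max_{r ∈ R} d(φ(r), 1), where φ also denotes the induced
homomorphism F(S) → G. -/
noncomputable def defect {S : Type} [Fintype S] (R : Finset (FreeGroup S)) {G : MetricGroup}
    (φ : S → G.carrier) : ℝ :=
  ((R.sup fun r => nndist ((FreeGroup.lift φ) r) 1 : NNReal) : ℝ)

/-- dist(φ, ψ) = max_{s ∈ S} d(φ(s), ψ(s)). -/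
noncomputable def mapDist {S : Type} [Fintype S] {G : MetricGroup} (φ ψ : S → G.carrier) : ℝ :=
  ((Finset.univ.sup fun s => nndist (φ s) (ψ s) : NNReal) : ℝ)

/-- A sequence of maps φₙ : S → Gₙ is an asymptotic homomorphism if
lim_{n→𝒰} defect(φₙ) = 0. -/
def IsAsymptoticHom {S : Type} [Fintype S] (𝒰 : Ultrafilter ℕ) (R : Finset (FreeGroup S))
    (G : ℕ → MetricGroup) (φ : ∀ n, S → (G n).carrier) : Prop :=
  Filter.Tendsto (fun n => defect R (φ n)) (𝒰 : Filter ℕ) (nhds 0)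

/-- φ' diminishes the defect of φ: (a) dist(φₙ, φ'ₙ) = O_𝒰(defect(φₙ)) and
(b) defect(φ'ₙ) = o_𝒰(defect(φₙ)). -/
def Diminishes {S : Type} [Fintype S] (𝒰 : Ultrafilter ℕ) (R : Finset (FreeGroup S))
    (G : ℕ → MetricGroup) (φ φ' : ∀ n, S → (G n).carrier) : Prop :=
  (∃ C : ℝ, 0 < C ∧ {n | mapDist (φ n) (φ' n) ≤ C * defect R (φ n)} ∈ 𝒰) ∧
  (∃ ε : ℕ → ℝ, (∀ n, 0 ≤ ε n) ∧ Filter.Tendsto ε (𝒰 : Filter ℕ) (nhds 0) ∧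
     ∀ n, defect R (φ' n) = ε n * defect R (φ n))

/-- The property of defect diminishing for the presentation ⟨S | R⟩ with respect to
the class 𝒞: every asymptotic homomorphism admits a sequence diminishing its defect. -/
def DefectDiminishing {S : Type} [Fintype S] (𝒰 : Ultrafilter ℕ) (𝒞 : Set MetricGroup)
    (R : Finset (FreeGroup S)) : Prop :=
  ∀ G : ℕ → MetricGroup, (∀ n, G n ∈ 𝒞) →
    ∀ φ : ∀ n, S → (G n).carrier, IsAsymptoticHom 𝒰 R G φ →
      ∃ φ' : ∀ n, S → (G n).carrier, Diminishes 𝒰 R G φ φ'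

section Helpers

theorem defect_nonneg' {S : Type} [Fintype S] (R : Finset (FreeGroup S)) {G : MetricGroup}
    (φ : S → G.carrier) : 0 ≤ defect R φ := NNReal.coe_nonneg _

theorem mapDist_nonneg' {S : Type} [Fintype S] {G : MetricGroup}
    (φ ψ : S → G.carrier) : 0 ≤ mapDist φ ψ := NNReal.coe_nonneg _

theorem dist_le_defect {S : Type} [Fintype S] (R : Finset (FreeGroup S)) {G : MetricGroup}
    (φ : S → G.carrier) {r : FreeGroup S} (hr : r ∈ R) :
    dist (FreeGroup.lift φ r) 1 ≤ defect R φ := by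
  have h := Finset.le_sup (f := fun r => nndist ((FreeGroup.lift φ) r) 1) hr
  exact_mod_cast h

theorem defect_le_of {S : Type} [Fintype S] (R : Finset (FreeGroup S)) {G : MetricGroup}
    (φ : S → G.carrier) {c : ℝ} (hc : 0 ≤ c)
    (h : ∀ r ∈ R, dist (FreeGroup.lift φ r) 1 ≤ c) : defect R φ ≤ c := by
  lift c to NNReal using hc
  unfold defect
  rw [NNReal.coe_le_coe]
  apply Finset.sup_le
  intro r hr
  exact_mod_cast h r hr

theorem dist_le_mapDist {S : Type} [Fintype S] {G : MetricGroup}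
    (φ ψ : S → G.carrier) (s : S) : dist (φ s) (ψ s) ≤ mapDist φ ψ := by
  have h := Finset.le_sup (f := fun s => nndist (φ s) (ψ s)) (Finset.mem_univ s)
  exact_mod_cast h

theorem mapDist_le_of {S : Type} [Fintype S] {G : MetricGroup}
    (φ ψ : S → G.carrier) {c : ℝ} (hc : 0 ≤ c)
    (h : ∀ s, dist (φ s) (ψ s) ≤ c) : mapDist φ ψ ≤ c := by
  lift c to NNReal using hc
  unfold mapDist
  rw [NNReal.coe_le_coe]
  apply Finset.sup_le
  intro s _
  exact_mod_cast h s

theorem mg_dist_mul_le (G : MetricGroup) (a b c d : G.carrier) :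
    dist (a * b) (c * d) ≤ dist a c + dist b d := by
  calc dist (a * b) (c * d) ≤ dist (a * b) (c * b) + dist (c * b) (c * d) := dist_triangle _ _ _
    _ = _ := by rw [G.dist_left_invariant, G.dist_right_invariant]

theorem mg_dist_inv (G : MetricGroup) (a b : G.carrier) :
    dist a⁻¹ b⁻¹ = dist a b := by
  rw [← G.dist_left_invariant a, ← G.dist_right_invariant b]
  simp [dist_comm]

theorem exists_const_normalClosure {S : Type} [Fintype S] (R : Finset (FreeGroup S))
    (w : FreeGroup S) (hw : w ∈ Subgroup.normalClosure (R : Set (FreeGroup S))) :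
    ∃ C : ℝ, 0 ≤ C ∧ ∀ (G : MetricGroup) (φ : S → G.carrier),
      dist (FreeGroup.lift φ w) 1 ≤ C * defect R φ := by
  rw [Subgroup.normalClosure] at hw
  induction hw using Subgroup.closure_induction with
  | mem x hx =>
    refine ⟨1, zero_le_one, fun G φ => ?_⟩
    obtain ⟨r, hr, hc⟩ := Group.mem_conjugatesOfSet_iff.1 hx
    obtain ⟨g, rfl⟩ := isConj_iff.1 hc
    have h1 := G.dist_left_invariant (FreeGroup.lift φ g) (FreeGroup.lift φ r) 1
    have h2 := G.dist_right_invariant (FreeGroup.lift φ g)⁻¹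
      (FreeGroup.lift φ g * FreeGroup.lift φ r) (FreeGroup.lift φ g * 1)
    have h3 := dist_le_defect R φ (Finset.mem_coe.1 hr)
    simp only [map_mul, map_inv, mul_one, mul_inv_cancel] at *
    linarith
  | one => exact ⟨0, le_rfl, fun G φ => by simp⟩
  | mul x y _ _ hx hy =>
    obtain ⟨C, hC, h⟩ := hx
    obtain ⟨D, hD, h'⟩ := hy
    refine ⟨C + D, by positivity, fun G φ => ?_⟩
    have := mg_dist_mul_le G (FreeGroup.lift φ x) (FreeGroup.lift φ y) 1 1
    rw [mul_one] at this
    rw [map_mul]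
    linarith [h G φ, h' G φ]
  | inv x _ hx =>
    obtain ⟨C, hC, h⟩ := hx
    refine ⟨C, hC, fun G φ => ?_⟩
    have := mg_dist_inv G (FreeGroup.lift φ x) 1
    rw [inv_one] at this
    rw [map_inv, this]
    exact h G φ

theorem exists_const_lift {S : Type} [Fintype S] (w : FreeGroup S) :
    ∃ C : ℝ, 0 ≤ C ∧ ∀ (G : MetricGroup) (φ ψ : S → G.carrier),
      dist (FreeGroup.lift φ w) (FreeGroup.lift ψ w) ≤ C * mapDist φ ψ := by
  induction w using FreeGroup.induction_on with
  | C1 => exact ⟨0, le_rfl, fun G φ ψ => by simp⟩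
  | of s =>
    exact ⟨1, zero_le_one, fun G φ ψ => by simpa using dist_le_mapDist φ ψ s⟩
  | inv_of s _ =>
    exact ⟨1, zero_le_one, fun G φ ψ => by
      simpa [mg_dist_inv] using dist_le_mapDist φ ψ s⟩
  | mul x y hx hy =>
    obtain ⟨C, hC, h⟩ := hx
    obtain ⟨D, hD, h'⟩ := hy
    refine ⟨C + D, by positivity, fun G φ ψ => ?_⟩
    rw [map_mul, map_mul]
    have := mg_dist_mul_le G (FreeGroup.lift φ x) (FreeGroup.lift φ y)
      (FreeGroup.lift ψ x) (FreeGroup.lift ψ y)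
    linarith [h G φ ψ, h' G φ ψ]

theorem exists_uniform {ι : Type} (T : Finset ι) (P : ι → ℝ → Prop)
    (hmono : ∀ i a b, a ≤ b → P i a → P i b) (h : ∀ i ∈ T, ∃ C : ℝ, 0 ≤ C ∧ P i C) :
    ∃ C : ℝ, 0 ≤ C ∧ ∀ i ∈ T, P i C := by
  classical
  induction T using Finset.induction_on with
  | empty => exact ⟨0, le_rfl, by simp⟩
  | insert a T _ ih =>
    obtain ⟨C, hC, h1⟩ := ih fun i hi => h i (Finset.mem_insert_of_mem hi)
    obtain ⟨D, hD, h2⟩ := h a (Finset.mem_insert_self _ _)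
    refine ⟨C + D, by positivity, fun i hi => ?_⟩
    rcases Finset.mem_insert.1 hi with rfl | hi
    · exact hmono _ _ _ (by linarith) h2
    · exact hmono _ _ _ (by linarith) (h1 i hi)

theorem exists_const_defect {S S' : Type} [Fintype S] [Fintype S']
    (R : Finset (FreeGroup S)) (R' : Finset (FreeGroup S')) (α : S' → FreeGroup S)
    (hα : ∀ r ∈ R', FreeGroup.lift α r ∈ Subgroup.normalClosure (R : Set (FreeGroup S))) :
    ∃ C : ℝ, 0 ≤ C ∧ ∀ (G : MetricGroup) (φ : S → G.carrier),
      defect R' (fun s => FreeGroup.lift φ (α s)) ≤ C * defect R φ := by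
  obtain ⟨C, hC, h⟩ := exists_uniform R' (fun r C => ∀ (G : MetricGroup) (φ : S → G.carrier),
      dist (FreeGroup.lift φ (FreeGroup.lift α r)) 1 ≤ C * defect R φ)
    (fun i a b hab h G φ => (h G φ).trans
      (mul_le_mul_of_nonneg_right hab (defect_nonneg' _ _)))
    (fun r hr => exists_const_normalClosure R _ (hα r hr))
  refine ⟨C, hC, fun G φ => defect_le_of _ _ (mul_nonneg hC (defect_nonneg' _ _)) fun r hr => ?_⟩
  have : FreeGroup.lift (fun s => FreeGroup.lift φ (α s)) =
      (FreeGroup.lift φ).comp (FreeGroup.lift α) := by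
    ext s; simp
  rw [this]
  exact h r hr G φ

theorem diminishing_transfer {S S' : Type} [Fintype S] [Fintype S']
    (R : Finset (FreeGroup S)) (R' : Finset (FreeGroup S'))
    (e : (FreeGroup S ⧸ Subgroup.normalClosure (R : Set (FreeGroup S))) ≃*
         (FreeGroup S' ⧸ Subgroup.normalClosure (R' : Set (FreeGroup S'))))
    (𝒞 : Set MetricGroup) (𝒰 : Ultrafilter ℕ)
    (hdd : DefectDiminishing 𝒰 𝒞 R') : DefectDiminishing 𝒰 𝒞 R := by
  have hα0 : ∀ s : S', ∃ w : FreeGroup S,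
      QuotientGroup.mk' (Subgroup.normalClosure (R : Set (FreeGroup S))) w =
      e.symm (QuotientGroup.mk' _ (FreeGroup.of s)) :=
    fun s => QuotientGroup.mk'_surjective _ _
  have hβ0 : ∀ s : S, ∃ w : FreeGroup S',
      QuotientGroup.mk' (Subgroup.normalClosure (R' : Set (FreeGroup S'))) w =
      e (QuotientGroup.mk' _ (FreeGroup.of s)) :=
    fun s => QuotientGroup.mk'_surjective _ _
  choose α hα using hα0
  choose β hβ using hβ0
  have hA : (QuotientGroup.mk' (Subgroup.normalClosure (R : Set (FreeGroup S)))).comp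
      (FreeGroup.lift α) = e.symm.toMonoidHom.comp (QuotientGroup.mk' _) := by
    ext s; simpa using hα s
  have hB : (QuotientGroup.mk' (Subgroup.normalClosure (R' : Set (FreeGroup S')))).comp
      (FreeGroup.lift β) = e.toMonoidHom.comp (QuotientGroup.mk' _) := by
    ext s; simpa using hβ s
  have hA' : ∀ r ∈ R', FreeGroup.lift α r ∈
      Subgroup.normalClosure (R : Set (FreeGroup S)) := by
    intro r hr
    have h1 := DFunLike.congr_fun hA r
    have h2 : (QuotientGroup.mk' (Subgroup.normalClosure (R' : Set (FreeGroup S')))) r = 1 :=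
      (QuotientGroup.eq_one_iff r).2 (Subgroup.subset_normalClosure hr)
    rw [MonoidHom.comp_apply, MonoidHom.comp_apply, h2, map_one] at h1
    exact (QuotientGroup.eq_one_iff _).1 h1
  have hB' : ∀ r ∈ R, FreeGroup.lift β r ∈
      Subgroup.normalClosure (R' : Set (FreeGroup S')) := by
    intro r hr
    have h1 := DFunLike.congr_fun hB r
    have h2 : (QuotientGroup.mk' (Subgroup.normalClosure (R : Set (FreeGroup S)))) r = 1 :=
      (QuotientGroup.eq_one_iff r).2 (Subgroup.subset_normalClosure hr)
    rw [MonoidHom.comp_apply, MonoidHom.comp_apply, h2, map_one] at h1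
    exact (QuotientGroup.eq_one_iff _).1 h1
  have hAB : ∀ s : S, (FreeGroup.of s)⁻¹ * FreeGroup.lift α (β s) ∈
      Subgroup.normalClosure (R : Set (FreeGroup S)) := by
    intro s
    rw [← QuotientGroup.eq]
    have h1 := DFunLike.congr_fun hA (β s)
    rw [MonoidHom.comp_apply, MonoidHom.comp_apply, hβ s] at h1
    have h2 : e.symm.toMonoidHom (e (QuotientGroup.mk' _ (FreeGroup.of s))) =
      QuotientGroup.mk' (Subgroup.normalClosure (R : Set (FreeGroup S))) (FreeGroup.of s) :=
      e.symm_apply_apply _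
    exact (h1.trans h2).symm
  obtain ⟨K₁, hK₁, h₁⟩ := exists_const_defect R R' α hA'
  obtain ⟨K₂, hK₂, h₂⟩ := exists_const_defect R' R β hB'
  obtain ⟨K₃, hK₃, h₃⟩ := exists_uniform (Finset.univ : Finset S)
    (fun s C => ∀ (G : MetricGroup) (φ : S → G.carrier),
      dist (FreeGroup.lift φ ((FreeGroup.of s)⁻¹ * FreeGroup.lift α (β s))) 1 ≤ C * defect R φ)
    (fun i a b hab h G φ => (h G φ).trans
      (mul_le_mul_of_nonneg_right hab (defect_nonneg' _ _)))
    (fun s _ => exists_const_normalClosure R _ (hAB s))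
  obtain ⟨K₄, hK₄, h₄⟩ := exists_uniform (Finset.univ : Finset S)
    (fun s C => ∀ (G : MetricGroup) (φ ψ : S' → G.carrier),
      dist (FreeGroup.lift φ (β s)) (FreeGroup.lift ψ (β s)) ≤ C * mapDist φ ψ)
    (fun i a b hab h G φ ψ => (h G φ ψ).trans
      (mul_le_mul_of_nonneg_right hab (mapDist_nonneg' _ _)))
    (fun s _ => exists_const_lift (β s))
  intro G hG φ hφ
  have hψ : IsAsymptoticHom 𝒰 R' G (fun n s => FreeGroup.lift (φ n) (α s)) := by
    refine squeeze_zero (fun n => defect_nonneg' _ _) (fun n => h₁ (G n) (φ n)) ?_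
    simpa using Filter.Tendsto.const_mul K₁ hφ
  obtain ⟨ψ', ⟨C, hC, hCmem⟩, ε, hε0, hεt, hε⟩ := hdd G hG _ hψ
  have key : ∀ n, defect R (fun s => FreeGroup.lift (ψ' n) (β s)) ≤
      (K₂ * K₁ * ε n) * defect R (φ n) := by
    intro n
    refine (h₂ (G n) (ψ' n)).trans ?_
    rw [hε n]
    have := mul_le_mul_of_nonneg_left (h₁ (G n) (φ n)) (mul_nonneg hK₂ (hε0 n))
    linarith
  refine ⟨fun n s => FreeGroup.lift (ψ' n) (β s), ⟨K₃ + K₄ * (C * K₁) + 1, by positivity, ?_⟩,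
    fun n => defect R (fun s => FreeGroup.lift (ψ' n) (β s)) / defect R (φ n),
    fun n => div_nonneg (defect_nonneg' _ _) (defect_nonneg' _ _), ?_, fun n => ?_⟩
  · filter_upwards [hCmem] with n hn
    have hd := defect_nonneg' R (φ n)
    refine mapDist_le_of _ _ (by positivity) fun s => ?_
    have e1 := h₃ s (Finset.mem_univ s) (G n) (φ n)
    rw [← (G n).dist_left_invariant (φ n s)] at e1
    have hcomp : FreeGroup.lift (φ n) (FreeGroup.lift α (β s)) =
        FreeGroup.lift (fun s => FreeGroup.lift (φ n) (α s)) (β s) := by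
      rw [← MonoidHom.comp_apply]
      congr 1
      ext s; simp
    simp only [map_mul, map_inv, FreeGroup.lift_apply_of, mul_inv_cancel_left, mul_one,
      hcomp] at e1
    rw [dist_comm] at e1
    have e2 := h₄ s (Finset.mem_univ s) (G n) (fun s => FreeGroup.lift (φ n) (α s)) (ψ' n)
    have e3 := mul_le_mul_of_nonneg_left hn hK₄
    have e4 := mul_le_mul_of_nonneg_left (h₁ (G n) (φ n)) (mul_nonneg hK₄ hC.le)
    have e5 := dist_triangle (φ n s)
      (FreeGroup.lift (fun s => FreeGroup.lift (φ n) (α s)) (β s)) (FreeGroup.lift (ψ' n) (β s))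
    linarith
  · refine squeeze_zero (fun n => div_nonneg (defect_nonneg' _ _) (defect_nonneg' _ _))
      (fun n => ?_) (by simpa using Filter.Tendsto.const_mul (K₂ * K₁) hεt)
    exact div_le_of_le_mul₀ (defect_nonneg' _ _)
      (mul_nonneg (mul_nonneg hK₂ hK₁) (hε0 n)) (key n)
  · rcases eq_or_ne (defect R (φ n)) 0 with h0 | h0
    · have := key n
      rw [h0, mul_zero] at this
      rw [h0, mul_zero]
      exact le_antisymm this (defect_nonneg' _ _)
    · rw [div_mul_cancel₀ _ h0]

end Helpers

/-- The property of defect diminishing does not depend on the finite presentation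
(for classes of groups with bi-invariant complete metrics): if
F(S)/⟨⟨R⟩⟩ ≅ F(S')/⟨⟨R'⟩⟩ then ⟨S | R⟩ has defect diminishing iff ⟨S' | R'⟩ has. -/
theorem defect_diminishing_independent_of_presentation
    {S S' : Type} [Fintype S] [Fintype S']
    (R : Finset (FreeGroup S)) (R' : Finset (FreeGroup S'))
    (e : (FreeGroup S ⧸ Subgroup.normalClosure (R : Set (FreeGroup S))) ≃*
         (FreeGroup S' ⧸ Subgroup.normalClosure (R' : Set (FreeGroup S'))))
    (𝒞 : Set MetricGroup) (hcomplete : ∀ G ∈ 𝒞, CompleteSpace G.carrier)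
    (𝒰 : Ultrafilter ℕ) (h𝒰 : (𝒰 : Filter ℕ) ≤ Filter.cofinite) :
    DefectDiminishing 𝒰 𝒞 R ↔ DefectDiminishing 𝒰 𝒞 R' := by
  exact ⟨diminishing_transfer R' R e.symm 𝒞 𝒰, diminishing_transfer R R' e 𝒞 𝒰⟩
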